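/- Let d ≥ 1 and let q_i (1 ≤ i ≤ 2^{d+1}−2) be a non-initial state of the cyclic tree automaton of depth d, with depth d_i and access word π_i ∈ {0,1}^{d_i}. Let C ∈ {0,1}^d be a challenge word whose prefix of length d_i equals π_i, and let (s_0,…,s_d) and (s'_0,…,s'_d) be the runs of C in A and in the pruned automaton A_{q_i}, respectively. Then s_j = s'_j for all 0 ≤ j < d_i, s_{d_i} = q_i ≠ s'_{d_i}, and the 2(d − d_i + 1) states s_{d_i},…,s_d, s'_{d_i},…,s'_d are pairwise distinct. -/

import Mathlib

/-- Transition function of the cyclic tree automaton of depth `d`: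
internal states `s ≤ 2^d − 2` go to children `2s+1` / `2s+2`,
leaf states go back to `1` / `2`. -/
def delta (d : ℕ) (s : ℕ) (b : Bool) : ℕ :=
  if s + 1 < 2 ^ d then 2 * s + (if b then 2 else 1) else if b then 2 else 1

/-- Transition function of the automaton pruned at state `i`:
every transition into `i` is redirected to the sibling transition. -/
def deltaP (d i : ℕ) (s : ℕ) (b : Bool) : ℕ :=
  if delta d s b = i then delta d s (!b) else delta d s b

/-- The states `s_1, …, s_n` visited after the start state by the run
of a challenge word, for a generic transition function `f`. -/
def visited (f : ℕ → Bool → ℕ) : ℕ → List Bool → List ℕ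
  | _, [] => []
  | s, b :: bs => f s b :: visited f (f s b) bs

/-- The full run `s_0, s_1, …, s_n` from state `s`. -/
def run (f : ℕ → Bool → ℕ) (s : ℕ) (C : List Bool) : List ℕ :=
  s :: visited f s C

/-- The final state of the run from `s`. -/
def runEnd (f : ℕ → Bool → ℕ) (s : ℕ) (C : List Bool) : ℕ :=
  C.foldl f s

/-- Output word `ℓ(s_1)⋯ℓ(s_n)` of the cyclic tree automaton. -/
def out (d : ℕ) (ℓ : ℕ → Bool) (C : List Bool) : List Bool :=
  (visited (delta d) 0 C).map ℓ

/-- Output word of the pruned automaton. -/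
def outP (d i : ℕ) (ℓ : ℕ → Bool) (C : List Bool) : List Bool :=
  (visited (deltaP d i) 0 C).map ℓ

/-- Interpret a labeling of the finite state set `{0,…,N−1}` as a labeling of `ℕ`. -/
def toLabel (N : ℕ) (ℓ : Fin N → Bool) : ℕ → Bool :=
  fun s => if h : s < N then ℓ ⟨s, h⟩ else false

def LV (k s : ℕ) : Prop := 2 ^ k ≤ s + 1 ∧ s + 1 < 2 ^ (k + 1)

lemma visited_append (f : ℕ → Bool → ℕ) (s : ℕ) (u v : List Bool) :
    visited f s (u ++ v) = visited f s u ++ visited f (u.foldl f s) v := by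
  induction u generalizing s with
  | nil => simp [visited]
  | cons b u ih => simp [visited, ih]

lemma visited_length (f : ℕ → Bool → ℕ) (s : ℕ) (u : List Bool) :
    (visited f s u).length = u.length := by
  induction u generalizing s with
  | nil => simp [visited]
  | cons b u ih => simp [visited, ih]

lemma LV_lt {d k s : ℕ} (h : LV k s) (hk : k < d) : s + 1 < 2 ^ d :=
  lt_of_lt_of_le h.2 (Nat.pow_le_pow_right (by norm_num) hk)

lemma LV_delta {d k s : ℕ} (b : Bool) (h : LV k s) (hk : k < d) : LV (k + 1) (delta d s b) := by
  have h1 := LV_lt h hk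
  obtain ⟨h2, h3⟩ := h
  have e1 : 2 ^ (k + 1) = 2 * 2 ^ k := by ring
  have e2 : 2 ^ (k + 1 + 1) = 2 * 2 ^ (k + 1) := by ring
  unfold LV delta
  rw [if_pos h1]
  cases b <;> simp <;> omega

lemma LV_ne {k l s t : ℕ} (h : LV k s) (h' : LV l t) (hkl : k < l) : s ≠ t := by
  rintro rfl
  have := LV_lt h hkl
  have := h'.1
  omega

lemma deltaP_eq {d i s : ℕ} {b : Bool} (h : delta d s b ≠ i) :
    deltaP d i s b = delta d s b := by
  simp [deltaP, h]

lemma LV_fold (d : ℕ) (u : List Bool) : ∀ k s, LV k s → k + u.length ≤ d →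
    LV (k + u.length) (u.foldl (delta d) s) := by
  induction u with
  | nil => intro k s h _; simpa using h
  | cons b u ih =>
    intro k s h hk
    simp only [List.length_cons] at hk
    have := ih (k + 1) _ (LV_delta b h (by omega : k < d)) (by omega)
    simp only [List.length_cons, List.foldl_cons]
    rwa [show k + (u.length + 1) = k + 1 + u.length by omega]

lemma below (d i m : ℕ) (hi : LV m i) (hm : m ≤ d) (u : List Bool) : ∀ k s, LV k s →
    (k + u.length < m ∨ (m ≤ k ∧ k + u.length ≤ d)) →
    visited (deltaP d i) s u = visited (delta d) s u ∧
      u.foldl (deltaP d i) s = u.foldl (delta d) s := by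
  induction u with
  | nil => intro k s h _; simp [visited]
  | cons b u ih =>
    intro k s h hk
    simp only [List.length_cons] at hk
    have hl := LV_delta b h (by omega : k < d)
    have hne : delta d s b ≠ i := by
      rcases hk with hk | hk
      · exact LV_ne hl hi (by omega)
      · exact (LV_ne hi hl (by omega)).symm
    have := ih (k + 1) _ hl (by omega)
    simp [visited, deltaP_eq hne, this]

lemma above (d : ℕ) (u : List Bool) : ∀ k s, LV k s → k + u.length ≤ d →
    ∀ x ∈ visited (delta d) s u, 2 ^ (k + 1) ≤ x + 1 := by
  induction u with
  | nil => intro k s h _; simp [visited]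
  | cons b u ih =>
    intro k s h hk x hx
    simp only [List.length_cons] at hk
    have hl := LV_delta b h (by omega : k < d)
    simp only [visited, List.mem_cons] at hx
    rcases hx with rfl | hx
    · exact hl.1
    · have := ih (k + 1) _ hl (by omega) x hx
      exact le_trans (Nat.pow_le_pow_right (by norm_num) (by omega)) this

lemma nodup_runs (d : ℕ) (u : List Bool) : ∀ k s t, LV k s → LV k t → s ≠ t →
    k + u.length ≤ d →
    ((s :: visited (delta d) s u) ++ (t :: visited (delta d) t u)).Nodup := by
  induction u with
  | nil => intro k s t _ _ h _; simpa [visited] using h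
  | cons b u ih =>
    intro k s t hs ht hne hk
    have as := above d _ k s hs hk
    have at' := above d _ k t ht hk
    simp only [List.length_cons] at hk
    have hne' : delta d s b ≠ delta d t b := by
      have h1 := LV_lt hs (by omega : k < d)
      have h2 := LV_lt ht (by omega : k < d)
      unfold delta
      rw [if_pos h1, if_pos h2]
      omega
    have key := ih (k + 1) _ _ (LV_delta b hs (by omega : k < d))
      (LV_delta b ht (by omega : k < d)) hne' (by omega)
    change (visited (delta d) s (b :: u) ++ visited (delta d) t (b :: u)).Nodup at key
    have hs2 := hs.2
    have ht2 := ht.2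
    have n1 : ∀ x, x + 1 < 2 ^ (k + 1) → x ∉ visited (delta d) s (b :: u) :=
      fun x hx hm => by have := as x hm; omega
    have n2 : ∀ x, x + 1 < 2 ^ (k + 1) → x ∉ visited (delta d) t (b :: u) :=
      fun x hx hm => by have := at' x hm; omega
    rw [List.cons_append, List.nodup_cons, List.perm_middle.nodup_iff, List.nodup_cons]
    refine ⟨?_, ?_, key⟩
    · simp only [List.mem_append, List.mem_cons, not_or]
      exact ⟨n1 s hs2, hne, n2 s hs2⟩
    · simp only [List.mem_append, not_or]
      exact ⟨n1 t ht2, n2 t ht2⟩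

/-- let `C` be a length-`d` challenge word whose prefix of length
`di` is the access word `π` of the pruned state `i`. Comparing the runs
`s_0, …, s_d` of `C` in the original automaton and `s'_0, …, s'_d` in the
pruned automaton: they agree on the first `di` states, then
`s_(di) = i ≠ s'_(di)`, and the `2(d - di + 1)` states
`s_(di), …, s_d, s'_(di), …, s'_d` are pairwise distinct. -/
theorem stmt9 (d i di : ℕ) (hd : 1 ≤ d)
    (hi1 : 1 ≤ i) (hi2 : i ≤ 2 ^ (d + 1) - 2)
    (hdi : di = Nat.log 2 (i + 1))
    (π : List Bool) (hπlen : π.length = di) (hπ : runEnd (delta d) 0 π = i)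
    (C : List Bool) (hC : C.length = d) (hpre : C.take di = π) :
    (run (delta d) 0 C).take di = (run (deltaP d i) 0 C).take di ∧
    (run (delta d) 0 C).getD di 0 = i ∧
    (run (deltaP d i) 0 C).getD di 0 ≠ i ∧
    ((run (delta d) 0 C).drop di ++ (run (deltaP d i) 0 C).drop di).Nodup := by
  have hLi : LV di i := by
    subst hdi
    exact ⟨Nat.pow_log_le_self 2 (by omega), Nat.lt_pow_succ_log_self (by norm_num) _⟩
  have hdi1 : 1 ≤ di := by
    rw [hdi]
    exact Nat.log_pos (by norm_num) (by omega)
  have hdd : di ≤ d := by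
    rw [← hπlen, ← hpre, ← hC, List.length_take]
    exact min_le_right _ _
  obtain ⟨ρ, b, rfl⟩ : ∃ ρ b, π = ρ ++ [b] := by
    rcases List.eq_nil_or_concat π with h | ⟨ρ, b, h⟩
    · subst h; simp at hπlen; omega
    · exact ⟨ρ, b, by simpa using h⟩
  obtain ⟨τ, rfl⟩ : ∃ τ, C = ρ ++ b :: τ :=
    ⟨C.drop di, by
      have := List.take_append_drop di C
      rw [hpre] at this
      simpa using this.symm⟩
  simp only [List.length_append, List.length_cons, List.length_nil] at hπlen hC
  have h0 : LV 0 0 := by simp [LV]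
  have hB := below d i di hLi hdd ρ 0 0 h0 (by omega)
  have hF := LV_fold d ρ 0 0 h0 (by omega)
  simp only [runEnd, List.foldl_append, List.foldl_cons, List.foldl_nil] at hπ
  set t := ρ.foldl (delta d) 0 with ht
  have hP : deltaP d i t b = delta d t (!b) := by simp [deltaP, hπ]
  have hL' := LV_delta (!b) hF (by omega : 0 + ρ.length < d)
  have hne : i ≠ delta d t (!b) := by
    have h1 := LV_lt hF (by omega : 0 + ρ.length < d)
    rw [← hπ]
    unfold delta
    rw [if_pos h1, if_pos h1]
    cases b <;> simp
  rw [show 0 + ρ.length + 1 = di by omega] at hL'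
  have hT := below d i di hLi hdd τ di _ hL' (by omega)
  have r1 : run (delta d) 0 (ρ ++ b :: τ) =
      (0 :: visited (delta d) 0 ρ) ++ (i :: visited (delta d) i τ) := by
    simp [run, visited_append, visited, ← ht, hπ]
  have r2 : run (deltaP d i) 0 (ρ ++ b :: τ) =
      (0 :: visited (delta d) 0 ρ) ++
        (delta d t (!b) :: visited (delta d) (delta d t (!b)) τ) := by
    simp [run, visited_append, visited, hB, hP, hT]
  have hlen : (0 :: visited (delta d) 0 ρ).length = di := by
    simp [visited_length]; omega
  rw [r1, r2]
  generalize (0 :: visited (delta d) 0 ρ) = P at hlen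
  subst hlen
  refine ⟨by simp, by simp, by simpa using hne.symm, ?_⟩
  rw [List.drop_left, List.drop_left]
  exact nodup_runs d τ _ _ _ hLi hL' hne (by omega)
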